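/- Consider the S2GD algorithm under the stated assumptions, and suppose additionally μ < L. Fix an integer k ≥ 1 and 0 < ε < 1, and set Δ := ε^{1/k} and κ := L/μ. If the algorithm is run for k epochs with stepsize h = 1 / ((4/Δ)(L − μ) + 2L) and with either (i) ν = μ and m ≥ (4(κ−1)/Δ + 2κ) · log( 2/Δ + (2κ−1)/(κ−1) ), or (ii) ν = 0 and m ≥ 8(κ−1)/Δ² + 8κ/Δ + 2κ²/(κ−1), then E[P(w^k) − P(w*)] ≤ ε (P(w^0) − P(w*)). -/

import Mathlib

open scoped RealInnerProductSpace BigOperators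

noncomputable section

/-- One stochastic inner step of the S2GD algorithm:
`y ↦ y − h (g + ∇f_i(y) − ∇f_i(w))`, where `g = ∇P(w)`. -/
def s2gdInnerStep {d n : ℕ}
    (f' : Fin n → EuclideanSpace ℝ (Fin d) → EuclideanSpace ℝ (Fin d)) (h : ℝ)
    (w g : EuclideanSpace ℝ (Fin d)) (i : Fin n) (y : EuclideanSpace ℝ (Fin d)) :
    EuclideanSpace ℝ (Fin d) :=
  y - h • (g + f' i y - f' i w)

/-- The result `y^{T}` of one S2GD epoch of length `T` (with `T ≤ m`) started at `w`,
where the `t`-th inner step (`t = 0, …, T−1`) uses the sampled index `σ t`. -/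
def s2gdEpoch {d n : ℕ}
    (f' : Fin n → EuclideanSpace ℝ (Fin d) → EuclideanSpace ℝ (Fin d))
    (P' : EuclideanSpace ℝ (Fin d) → EuclideanSpace ℝ (Fin d)) (h : ℝ) (m : ℕ)
    (w : EuclideanSpace ℝ (Fin d)) (T : ℕ) (σ : Fin m → Fin n) :
    EuclideanSpace ℝ (Fin d) :=
  (List.finRange m).foldl
    (fun y (t : Fin m) => if (t : ℕ) < T then s2gdInnerStep f' h w (P' w) (σ t) y else y) w

/-- The iterate `w^k` produced by `k` epochs of S2GD started from `w0`, given the random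
seed `ω`: in epoch `j`, the epoch length is `t^j = (ω j).1 + 1 ∈ {1, …, m}` and the indices
sampled in the inner loop are given by `(ω j).2`. -/
def s2gdIterate {d n : ℕ}
    (f' : Fin n → EuclideanSpace ℝ (Fin d) → EuclideanSpace ℝ (Fin d))
    (P' : EuclideanSpace ℝ (Fin d) → EuclideanSpace ℝ (Fin d)) (h : ℝ) (m : ℕ)
    (w0 : EuclideanSpace ℝ (Fin d)) (k : ℕ) (ω : Fin k → Fin m × (Fin m → Fin n)) :
    EuclideanSpace ℝ (Fin d) :=
  (List.finRange k).foldl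
    (fun w j => s2gdEpoch f' P' h m w (((ω j).1 : ℕ) + 1) (ω j).2) w0

/-- The probability of the random seed `ω` of `k` epochs of S2GD: each epoch length
`t = T+1` has probability `(1 − νh)^{m−t} / β` and each of the `m` uniform index draws of an
epoch has probability `1/n`. -/
def s2gdWeight (n : ℕ) (ν h β : ℝ) (m : ℕ) {k : ℕ}
    (ω : Fin k → Fin m × (Fin m → Fin n)) : ℝ :=
  ∏ j, ((1 - ν * h) ^ (m - (((ω j).1 : ℕ) + 1)) / β) * ((1 : ℝ) / (n : ℝ)) ^ m


section conv
variable {E : Type*} [NormedAddCommGroup E] [InnerProductSpace ℝ E] [CompleteSpace E]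

lemma aux_hasDerivAt_line {f : E → ℝ} {f' : E → E} (hg : ∀ x, HasGradientAt f (f' x) x)
    (x v : E) (t : ℝ) : HasDerivAt (fun t : ℝ => f (x + t • v)) ⟪f' (x + t • v), v⟫ t := by
  have h1 : HasDerivAt (fun t : ℝ => x + t • v) v t := by
    simpa using ((hasDerivAt_id t).smul_const v).const_add x
  have h2 := (hg (x + t • v)).hasFDerivAt.comp_hasDerivAt t h1
  simp only [InnerProductSpace.toDual_apply_apply] at h2
  exact h2

lemma aux_first_order {f : E → ℝ} {f' : E → E} (hg : ∀ x, HasGradientAt f (f' x) x)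
    (hc : ConvexOn ℝ Set.univ f) (x z : E) : f x + ⟪f' x, z - x⟫ ≤ f z := by
  have h1 := aux_hasDerivAt_line hg x (z - x) 0
  have hc' : ConvexOn ℝ Set.univ (fun t : ℝ => f (x + t • (z - x))) := by
    refine ⟨convex_univ, fun a _ b _ s t hs ht hst => ?_⟩
    have := hc.2 (Set.mem_univ (x + a • (z - x))) (Set.mem_univ (x + b • (z - x))) hs ht hst
    convert this using 2
    obtain rfl : s = 1 - t := by linarith
    simp only [smul_eq_mul]
    module
  have h2 := hc'.le_slope_of_hasDerivAt (Set.mem_univ 0) (Set.mem_univ 1) one_pos h1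
  simp [slope_def_field] at h2
  linarith

lemma aux_descent {f : E → ℝ} {f' : E → E} (hg : ∀ x, HasGradientAt f (f' x) x) {L : ℝ}
    (hLip : ∀ x y, ‖f' x - f' y‖ ≤ L * ‖x - y‖) (x z : E) :
    f z ≤ f x + ⟪f' x, z - x⟫ + L / 2 * ‖z - x‖ ^ 2 := by
  set v := z - x with hv
  have hd : ∀ t : ℝ, HasDerivAt
      (fun t : ℝ => f (x + t • v) - t * ⟪f' x, v⟫ - t ^ 2 * (L / 2 * ‖v‖ ^ 2))
      (⟪f' (x + t • v), v⟫ - ⟪f' x, v⟫ - 2 * t * (L / 2 * ‖v‖ ^ 2)) t := by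
    intro t
    have h1 := aux_hasDerivAt_line hg x v t
    have h2 := (hasDerivAt_id t).mul_const ⟪f' x, v⟫
    have h3 := (hasDerivAt_pow 2 t).mul_const (L / 2 * ‖v‖ ^ 2)
    have h4 := (h1.sub h2).sub h3
    refine HasDerivAt.congr_deriv h4 ?_
    simp
  have hanti : AntitoneOn
      (fun t : ℝ => f (x + t • v) - t * ⟪f' x, v⟫ - t ^ 2 * (L / 2 * ‖v‖ ^ 2)) (Set.Icc 0 1) := by
    apply antitoneOn_of_deriv_nonpos (convex_Icc 0 1)
    · exact fun t _ => (hd t).continuousAt.continuousWithinAt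
    · exact fun t _ => (hd t).differentiableAt.differentiableWithinAt
    · intro t ht
      rw [interior_Icc] at ht
      rw [(hd t).deriv, ← inner_sub_left]
      have h1 := real_inner_le_norm (f' (x + t • v) - f' x) v
      have h2 := hLip (x + t • v) x
      rw [add_sub_cancel_left, norm_smul, Real.norm_of_nonneg ht.1.le] at h2
      have h3 := mul_le_mul_of_nonneg_right h2 (norm_nonneg v)
      nlinarith
  have := hanti (Set.left_mem_Icc.2 zero_le_one) (Set.right_mem_Icc.2 zero_le_one) zero_le_one
  simp [hv] at this
  simp only [hv]
  linarith

lemma aux_coco {f : E → ℝ} {f' : E → E} (hg : ∀ x, HasGradientAt f (f' x) x)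
    (hc : ConvexOn ℝ Set.univ f) {L : ℝ} (hL : 0 < L)
    (hLip : ∀ x y, ‖f' x - f' y‖ ≤ L * ‖x - y‖) (x y : E) :
    ‖f' y - f' x‖ ^ 2 ≤ 2 * L * (f y - f x - ⟪f' x, y - x⟫) := by
  have h1 := aux_first_order hg hc x (y - (1 / L) • (f' y - f' x))
  have h2 := aux_descent hg hLip y (y - (1 / L) • (f' y - f' x))
  have e1 : y - (1 / L) • (f' y - f' x) - x = (y - x) - (1 / L) • (f' y - f' x) := by abel
  have e2 : y - (1 / L) • (f' y - f' x) - y = - ((1 / L) • (f' y - f' x)) := by abel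
  rw [e1, inner_sub_right, real_inner_smul_right] at h1
  rw [e2, inner_neg_right, real_inner_smul_right, norm_neg, norm_smul, mul_pow,
    Real.norm_of_nonneg (by positivity)] at h2
  have e3 : ⟪f' y, f' y - f' x⟫ - ⟪f' x, f' y - f' x⟫ = ‖f' y - f' x‖ ^ 2 := by
    rw [← inner_sub_left, real_inner_self_eq_norm_sq]
  have h3 : 1 / L * (⟪f' y, f' y - f' x⟫ - ⟪f' x, f' y - f' x⟫)
     - L / 2 * ((1 / L) ^ 2 * ‖f' y - f' x‖ ^ 2) ≤ f y - f x - ⟪f' x, y - x⟫ := by linarith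
  rw [e3] at h3
  have h4 : 1 / L * ‖f' y - f' x‖ ^ 2 - L / 2 * ((1 / L) ^ 2 * ‖f' y - f' x‖ ^ 2)
    = ‖f' y - f' x‖ ^ 2 / (2 * L) := by field_simp; ring
  rw [h4, div_le_iff₀ (by positivity)] at h3
  linarith
end conv

section fold
variable {X α : Type*} [Fintype α]

lemma aux_fold_succ {m : ℕ} (c : α → ℝ) (s : Fin (m + 1) → α → X → X) (Φ : X → ℝ) (x : X) :
    ∑ σ : Fin (m + 1) → α, (∏ j, c (σ j)) *
      Φ ((List.finRange (m + 1)).foldl (fun y t => s t (σ t) y) x)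
    = ∑ a, c a * ∑ σ : Fin m → α, (∏ j, c (σ j)) *
      Φ ((List.finRange m).foldl (fun y t => s t.succ (σ t) y) (s 0 a x)) := by
  rw [← (Fin.consEquiv (fun _ => α)).sum_comp, Fintype.sum_prod_type]
  refine Finset.sum_congr rfl fun a _ => ?_
  rw [Finset.mul_sum]
  refine Finset.sum_congr rfl fun σ _ => ?_
  simp [Fin.consEquiv, Fin.prod_univ_succ, List.finRange_succ, List.foldl_map, mul_assoc]

lemma aux_fold_contract (c : α → ℝ) (hc : ∀ a, 0 ≤ c a) (s : α → X → X) (p : X → ℝ) (Δ : ℝ)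
    (hs : ∀ w, ∑ a, c a * p (s a w) ≤ Δ * p w) (hΔ : 0 ≤ Δ) (k : ℕ) (w : X) :
    ∑ σ : Fin k → α, (∏ j, c (σ j)) *
      p ((List.finRange k).foldl (fun y t => s (σ t) y) w) ≤ Δ ^ k * p w := by
  induction k generalizing w with
  | zero => simp
  | succ k ih =>
    rw [aux_fold_succ c (fun _ => s)]
    calc _ ≤ ∑ a, c a * (Δ ^ k * p (s a w)) :=
          Finset.sum_le_sum fun a _ => mul_le_mul_of_nonneg_left (ih _) (hc a)
      _ = Δ ^ k * ∑ a, c a * p (s a w) := by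
          rw [Finset.mul_sum]; exact Finset.sum_congr rfl fun a _ => by ring
      _ ≤ Δ ^ k * (Δ * p w) := mul_le_mul_of_nonneg_left (hs w) (by positivity)
      _ = _ := by ring

/-- averaging operator -/
def auxA (c : ℝ) (s : α → X → X) (Φ : X → ℝ) : X → ℝ := fun y => ∑ a, c * Φ (s a y)

lemma aux_fold_A (c : ℝ) (hc : ∑ _a : α, c = 1) (s : α → X → X) (Φ : X → ℝ) (m T : ℕ) (hT : T ≤ m)
    (w : X) :
    ∑ σ : Fin m → α, c ^ m *
      Φ ((List.finRange m).foldl (fun y (t : Fin m) => if (t : ℕ) < T then s (σ t) y else y) w)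
    = (auxA c s)^[T] Φ w := by
  induction m generalizing T w with
  | zero => obtain rfl : T = 0 := by omega
            simp
  | succ m ih =>
    have h := aux_fold_succ (m := m) (fun _ : α => c)
      (fun t a y => if (t : ℕ) < T then s a y else y) Φ w
    simp only [Finset.prod_const, Finset.card_univ, Fintype.card_fin] at h
    rw [h]
    cases T with
    | zero =>
      have := ih 0 (by omega)
      simp only [Nat.not_lt_zero, if_false] at this ⊢
      simp only [this]
      rw [← Finset.sum_mul, hc, one_mul]
    | succ T =>
      have := ih T (by omega)
      simp only [Fin.val_succ, Nat.succ_lt_succ_iff, this, Fin.val_zero,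
        Nat.succ_pos, if_true]
      rw [Function.iterate_succ_apply']; rfl

lemma auxA_iter_le (c : ℝ) (hc0 : 0 ≤ c) (hc : ∑ _a : α, c = 1) (s : α → X → X)
    (Φ₁ Φ₂ Φ₃ : X → ℝ) (a b C : ℝ)
    (h : ∀ y, Φ₁ y ≤ a * Φ₂ y + b * Φ₃ y + C) (t : ℕ) (y : X) :
    (auxA c s)^[t] Φ₁ y ≤ a * (auxA c s)^[t] Φ₂ y + b * (auxA c s)^[t] Φ₃ y + C := by
  induction t generalizing y with
  | zero => exact h y
  | succ t ih =>
    simp only [Function.iterate_succ_apply']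
    calc _ ≤ ∑ i, c * (a * (auxA c s)^[t] Φ₂ (s i y) + b * (auxA c s)^[t] Φ₃ (s i y) + C) :=
          Finset.sum_le_sum fun i _ => mul_le_mul_of_nonneg_left (ih _) hc0
      _ = a * (∑ i, c * (auxA c s)^[t] Φ₂ (s i y)) + b * (∑ i, c * (auxA c s)^[t] Φ₃ (s i y))
          + (∑ _i : α, c) * C := by
          rw [Finset.mul_sum, Finset.mul_sum, Finset.sum_mul, ← Finset.sum_add_distrib,
            ← Finset.sum_add_distrib]
          exact Finset.sum_congr rfl fun i _ => by ring
      _ = _ := by rw [hc, one_mul]; rfl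
end fold

lemma aux_telescope (s p : ℕ → ℝ) (q b C : ℝ) (hq : 0 ≤ q)
    (h : ∀ t, s (t + 1) + b * p t ≤ q * s t + C) (m : ℕ) :
    s m + b * ∑ t ∈ Finset.range m, q ^ (m - (t + 1)) * p t
      ≤ q ^ m * s 0 + C * ∑ t ∈ Finset.range m, q ^ (m - (t + 1)) := by
  induction m with
  | zero => simp
  | succ m ih =>
    have e : ∀ u : ℕ → ℝ, ∑ t ∈ Finset.range (m + 1), q ^ (m + 1 - (t + 1)) * u t
        = q * (∑ t ∈ Finset.range m, q ^ (m - (t + 1)) * u t) + u m := by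
      intro u
      rw [Finset.sum_range_succ, Finset.mul_sum]
      congr 1
      · refine Finset.sum_congr rfl fun t ht => ?_
        have := Finset.mem_range.1 ht
        rw [show m + 1 - (t + 1) = (m - (t + 1)) + 1 by omega, pow_succ]; ring
      · simp
    have e1 := e (fun _ => 1)
    simp only [mul_one] at e1
    rw [e p, e1]
    have := mul_le_mul_of_nonneg_left ih hq
    have := h m
    rw [pow_succ]
    nlinarith

lemma aux_avg_lin {n : ℕ} (c : ℝ) (hc : ∑ _i : Fin n, c = 1) (u v a b d e : Fin n → ℝ)
    (A B G h : ℝ) :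
    ∑ i, c * (A - 2 * h * (B + u i - v i) + h ^ 2 * (2 * a i + 2 * (b i - 2 * (d i - e i) + G)))
    = A - 2 * h * (B + ∑ i, c * u i - ∑ i, c * v i) + h ^ 2 * (2 * ∑ i, c * a i
      + 2 * (∑ i, c * b i - 2 * (∑ i, c * d i - ∑ i, c * e i) + G)) := by
  have : A - 2 * h * (B + ∑ i, c * u i - ∑ i, c * v i) + h ^ 2 * (2 * ∑ i, c * a i
      + 2 * (∑ i, c * b i - 2 * (∑ i, c * d i - ∑ i, c * e i) + G))
    = (∑ _i : Fin n, c) * A - 2 * h * ((∑ _i : Fin n, c) * B + ∑ i, c * u i - ∑ i, c * v i)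
      + h ^ 2 * (2 * ∑ i, c * a i
      + 2 * (∑ i, c * b i - 2 * (∑ i, c * d i - ∑ i, c * e i) + (∑ _i : Fin n, c) * G)) := by
    rw [hc]; ring
  rw [this]
  simp only [Finset.mul_sum, Finset.sum_mul, ← Finset.sum_add_distrib, ← Finset.sum_sub_distrib]
  exact Finset.sum_congr rfl fun i _ => by ring

section main

lemma aux_c {n : ℕ}
    (hn : 0 < n)
    : ∑ _i : Fin n, (1 / (n : ℝ)) = 1 := by
  have : (n : ℝ) ≠ 0 := by positivity
  simp [this]

lemma aux_inner {d n : ℕ}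
    (f' : Fin n → EuclideanSpace ℝ (Fin d) → EuclideanSpace ℝ (Fin d))
    (P' : EuclideanSpace ℝ (Fin d) → EuclideanSpace ℝ (Fin d))
    (hP' : ∀ w, P' w = (1 / (n : ℝ)) • ∑ i, f' i w)
    (y v : EuclideanSpace ℝ (Fin d)) :
    ∑ i, (1 / (n : ℝ)) * ⟪f' i y, v⟫ = ⟪P' y, v⟫ := by
  rw [hP', real_inner_smul_left, sum_inner, Finset.mul_sum]

lemma aux_grad_zero {d n : ℕ}
    (f : Fin n → EuclideanSpace ℝ (Fin d) → ℝ)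
    (f' : Fin n → EuclideanSpace ℝ (Fin d) → EuclideanSpace ℝ (Fin d))
    (hgrad : ∀ i x, HasGradientAt (f i) (f' i x) x)
    (P : EuclideanSpace ℝ (Fin d) → ℝ)
    (hP : ∀ w, P w = (1 / (n : ℝ)) * ∑ i, f i w)
    (P' : EuclideanSpace ℝ (Fin d) → EuclideanSpace ℝ (Fin d))
    (hP' : ∀ w, P' w = (1 / (n : ℝ)) • ∑ i, f' i w)
    (wstar : EuclideanSpace ℝ (Fin d))
    (hmin : ∀ w, P wstar ≤ P w)
    : P' wstar = 0 := by
  have hd : HasFDerivAt P ((1 / (n : ℝ)) • ∑ i, InnerProductSpace.toDual ℝ _ (f' i wstar)) wstar := by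
    have := (HasFDerivAt.fun_sum (u := Finset.univ)
      (fun i _ => (hgrad i wstar).hasFDerivAt)).const_mul (1 / (n : ℝ))
    rw [show P = fun w => (1 / (n : ℝ)) * ∑ i, f i w from funext hP]
    exact this
  have hz : IsLocalMin P wstar := Filter.Eventually.of_forall hmin
  have h0 := hz.hasFDerivAt_eq_zero hd
  have h1 := congrArg (fun l => l (P' wstar)) h0
  simp only [smul_apply, sum_apply,
    InnerProductSpace.toDual_apply_apply, zero_apply, smul_eq_mul,
    Finset.mul_sum] at h1
  rw [aux_inner f' P' hP'] at h1
  exact inner_self_eq_zero.1 h1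

lemma aux_var {d n : ℕ}
    (f : Fin n → EuclideanSpace ℝ (Fin d) → ℝ)
    (f' : Fin n → EuclideanSpace ℝ (Fin d) → EuclideanSpace ℝ (Fin d))
    (hgrad : ∀ i x, HasGradientAt (f i) (f' i x) x)
    (hconvex : ∀ i, ConvexOn ℝ Set.univ (f i))
    (L : ℝ)
    (hL : 0 < L)
    (hLip : ∀ i (x y : EuclideanSpace ℝ (Fin d)), ‖f' i x - f' i y‖ ≤ L * ‖x - y‖)
    (P : EuclideanSpace ℝ (Fin d) → ℝ)
    (hP : ∀ w, P w = (1 / (n : ℝ)) * ∑ i, f i w)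
    (P' : EuclideanSpace ℝ (Fin d) → EuclideanSpace ℝ (Fin d))
    (hP' : ∀ w, P' w = (1 / (n : ℝ)) • ∑ i, f' i w)
    (wstar : EuclideanSpace ℝ (Fin d))
    (hmin : ∀ w, P wstar ≤ P w)
    (y : EuclideanSpace ℝ (Fin d)) :
    ∑ i, (1 / (n : ℝ)) * ‖f' i y - f' i wstar‖ ^ 2 ≤ 2 * L * (P y - P wstar) := by
  calc _ ≤ ∑ i, (1 / (n : ℝ)) * (2 * L * (f i y - f i wstar - ⟪f' i wstar, y - wstar⟫)) :=
        Finset.sum_le_sum fun i _ => mul_le_mul_of_nonneg_left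
          (aux_coco (hgrad i) (hconvex i) hL (hLip i) wstar y) (by positivity)
    _ = 2 * L * (∑ i, (1 / (n : ℝ)) * f i y - ∑ i, (1 / (n : ℝ)) * f i wstar
          - ∑ i, (1 / (n : ℝ)) * ⟪f' i wstar, y - wstar⟫) := by
        simp only [Finset.mul_sum, ← Finset.sum_sub_distrib]
        exact Finset.sum_congr rfl fun i _ => by ring
    _ = _ := by
        rw [aux_inner f' P' hP', aux_grad_zero f f' hgrad P hP P' hP' wstar hmin,
          ← Finset.mul_sum, ← Finset.mul_sum, ← hP, ← hP]
        simp

lemma aux_PL {d : ℕ}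
    (P : EuclideanSpace ℝ (Fin d) → ℝ)
    (P' : EuclideanSpace ℝ (Fin d) → EuclideanSpace ℝ (Fin d))
    (μ : ℝ)
    (hμ : 0 < μ)
    (hstrong : ∀ x z : EuclideanSpace ℝ (Fin d), P x + ⟪P' x, z - x⟫ + μ / 2 * ‖z - x‖ ^ 2 ≤ P z)
    (wstar : EuclideanSpace ℝ (Fin d))
    (w : EuclideanSpace ℝ (Fin d)) : 2 * μ * (P w - P wstar) ≤ ‖P' w‖ ^ 2 := by
  have h1 := hstrong w wstar
  have h2 : 0 ≤ ‖P' w + μ • (wstar - w)‖ ^ 2 := by positivity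
  rw [norm_add_sq_real, real_inner_smul_right, norm_smul, mul_pow, Real.norm_of_nonneg hμ.le] at h2
  nlinarith

lemma aux_gsq {d n : ℕ}
    (hn : 0 < n)
    (f : Fin n → EuclideanSpace ℝ (Fin d) → ℝ)
    (f' : Fin n → EuclideanSpace ℝ (Fin d) → EuclideanSpace ℝ (Fin d))
    (hgrad : ∀ i x, HasGradientAt (f i) (f' i x) x)
    (hconvex : ∀ i, ConvexOn ℝ Set.univ (f i))
    (L : ℝ)
    (hL : 0 < L)
    (hLip : ∀ i (x y : EuclideanSpace ℝ (Fin d)), ‖f' i x - f' i y‖ ≤ L * ‖x - y‖)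
    (P : EuclideanSpace ℝ (Fin d) → ℝ)
    (hP : ∀ w, P w = (1 / (n : ℝ)) * ∑ i, f i w)
    (P' : EuclideanSpace ℝ (Fin d) → EuclideanSpace ℝ (Fin d))
    (hP' : ∀ w, P' w = (1 / (n : ℝ)) • ∑ i, f' i w)
    (wstar : EuclideanSpace ℝ (Fin d))
    (hmin : ∀ w, P wstar ≤ P w)
    (w : EuclideanSpace ℝ (Fin d)) : ‖P' w‖ ^ 2 ≤ 2 * L * (P w - P wstar) := by
  refine le_trans ?_ (aux_var f f' hgrad hconvex L hL hLip P hP P' hP' wstar hmin w)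
  have h0 := aux_grad_zero f f' hgrad P hP P' hP' wstar hmin
  have h1 : ∑ i, (1 / (n : ℝ)) * (2 * ⟪f' i w, P' w⟫ - 2 * ⟪f' i wstar, P' w⟫ - ‖P' w‖ ^ 2)
      ≤ ∑ i, (1 / (n : ℝ)) * ‖f' i w - f' i wstar‖ ^ 2 := by
    refine Finset.sum_le_sum fun i _ => mul_le_mul_of_nonneg_left ?_ (by positivity)
    have : 0 ≤ ‖(f' i w - f' i wstar) - P' w‖ ^ 2 := by positivity
    rw [norm_sub_sq_real, inner_sub_left] at this
    linarith
  refine le_trans (le_of_eq ?_) h1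
  have h2 : ∑ i, (1 / (n : ℝ)) * (2 * ⟪f' i w, P' w⟫ - 2 * ⟪f' i wstar, P' w⟫ - ‖P' w‖ ^ 2)
     = 2 * ∑ i, (1 / (n : ℝ)) * ⟪f' i w, P' w⟫ - 2 * ∑ i, (1 / (n : ℝ)) * ⟪f' i wstar, P' w⟫
       - (∑ _i : Fin n, (1 / (n : ℝ))) * ‖P' w‖ ^ 2 := by
    simp only [Finset.mul_sum, Finset.sum_mul, ← Finset.sum_sub_distrib]
    exact Finset.sum_congr rfl fun i _ => by ring
  rw [h2, aux_c hn, aux_inner f' P' hP', aux_inner f' P' hP', h0, real_inner_self_eq_norm_sq,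
    inner_zero_left]
  ring

lemma aux_step {d n : ℕ}
    (hn : 0 < n)
    (f : Fin n → EuclideanSpace ℝ (Fin d) → ℝ)
    (f' : Fin n → EuclideanSpace ℝ (Fin d) → EuclideanSpace ℝ (Fin d))
    (hgrad : ∀ i x, HasGradientAt (f i) (f' i x) x)
    (hconvex : ∀ i, ConvexOn ℝ Set.univ (f i))
    (L : ℝ)
    (hL : 0 < L)
    (hLip : ∀ i (x y : EuclideanSpace ℝ (Fin d)), ‖f' i x - f' i y‖ ≤ L * ‖x - y‖)
    (P : EuclideanSpace ℝ (Fin d) → ℝ)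
    (hP : ∀ w, P w = (1 / (n : ℝ)) * ∑ i, f i w)
    (P' : EuclideanSpace ℝ (Fin d) → EuclideanSpace ℝ (Fin d))
    (hP' : ∀ w, P' w = (1 / (n : ℝ)) • ∑ i, f' i w)
    (μ : ℝ)
    (hμ : 0 < μ)
    (hstrong : ∀ x z : EuclideanSpace ℝ (Fin d), P x + ⟪P' x, z - x⟫ + μ / 2 * ‖z - x‖ ^ 2 ≤ P z)
    (wstar : EuclideanSpace ℝ (Fin d))
    (hmin : ∀ w, P wstar ≤ P w)
    (h ν : ℝ) (hh : 0 < h) (hν : ν ≤ μ) (w y : EuclideanSpace ℝ (Fin d)) :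
    ∑ i, (1 / (n : ℝ)) * ‖s2gdInnerStep f' h w (P' w) i y - wstar‖ ^ 2
      ≤ (1 - ν * h) * ‖y - wstar‖ ^ 2 + (-(2 * h * (1 - 2 * L * h))) * (P y - P wstar)
        + 4 * (L - μ) * h ^ 2 * (P w - P wstar) := by
  have h0 := aux_grad_zero f f' hgrad P hP P' hP' wstar hmin
  have hpt : ∀ i, ‖s2gdInnerStep f' h w (P' w) i y - wstar‖ ^ 2 ≤
      ‖y - wstar‖ ^ 2 - 2 * h * (⟪P' w, y - wstar⟫ + ⟪f' i y, y - wstar⟫ - ⟪f' i w, y - wstar⟫)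
      + h ^ 2 * (2 * ‖f' i y - f' i wstar‖ ^ 2 + 2 * (‖f' i w - f' i wstar‖ ^ 2
        - 2 * (⟪f' i w, P' w⟫ - ⟪f' i wstar, P' w⟫) + ‖P' w‖ ^ 2)) := by
    intro i
    have e1 : s2gdInnerStep f' h w (P' w) i y - wstar
      = (y - wstar) - h • (P' w + f' i y - f' i w) := by
      unfold s2gdInnerStep; abel
    have e2 : P' w + f' i y - f' i w
      = (f' i y - f' i wstar) - ((f' i w - f' i wstar) - P' w) := by abel
    have e3 : ⟪y - wstar, P' w + f' i y - f' i w⟫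
      = ⟪P' w, y - wstar⟫ + ⟪f' i y, y - wstar⟫ - ⟪f' i w, y - wstar⟫ := by
      rw [real_inner_comm, inner_sub_left, inner_add_left]
    have e4 : ‖P' w + f' i y - f' i w‖ ^ 2 ≤ 2 * ‖f' i y - f' i wstar‖ ^ 2
        + 2 * ‖(f' i w - f' i wstar) - P' w‖ ^ 2 := by
      rw [e2]
      have := parallelogram_law_with_norm ℝ (f' i y - f' i wstar) ((f' i w - f' i wstar) - P' w)
      nlinarith [mul_self_nonneg ‖(f' i y - f' i wstar) + ((f' i w - f' i wstar) - P' w)‖]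
    rw [norm_sub_sq_real (f' i w - f' i wstar), inner_sub_left] at e4
    rw [e1, norm_sub_sq_real, real_inner_smul_right, e3, norm_smul, mul_pow,
      Real.norm_of_nonneg hh.le]
    nlinarith [mul_le_mul_of_nonneg_left e4 (sq_nonneg h)]
  have h1 := Finset.sum_le_sum fun i (_ : i ∈ Finset.univ) =>
    mul_le_mul_of_nonneg_left (hpt i) (show 0 ≤ 1 / (n : ℝ) by positivity)
  rw [aux_avg_lin _ (aux_c hn)] at h1
  simp only [aux_inner f' P' hP'] at h1
  rw [h0, inner_zero_left, real_inner_self_eq_norm_sq] at h1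
  have va := aux_var f f' hgrad hconvex L hL hLip P hP P' hP' wstar hmin y
  have vb := aux_var f f' hgrad hconvex L hL hLip P hP P' hP' wstar hmin w
  have pl := aux_PL P P' μ hμ hstrong wstar w
  have st := hstrong y wstar
  have e5 : ⟪P' y, wstar - y⟫ = - ⟪P' y, y - wstar⟫ := by rw [← inner_neg_right, neg_sub]
  rw [e5, norm_sub_rev] at st
  have hR : ν * ‖y - wstar‖ ^ 2 ≤ μ * ‖y - wstar‖ ^ 2 :=
    mul_le_mul_of_nonneg_right hν (by positivity)
  have k1 : 2 * h * (P y - P wstar + ν / 2 * ‖y - wstar‖ ^ 2) ≤ 2 * h * ⟪P' y, y - wstar⟫ :=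
    mul_le_mul_of_nonneg_left (by linarith) (by positivity)
  refine h1.trans ?_
  set Sa := ∑ i, (1 / (n : ℝ)) * ‖f' i y - f' i wstar‖ ^ 2
  set Sb := ∑ i, (1 / (n : ℝ)) * ‖f' i w - f' i wstar‖ ^ 2
  have k2 : h ^ 2 * (2 * Sa + 2 * (Sb - 2 * (‖P' w‖ ^ 2 - 0) + ‖P' w‖ ^ 2))
      ≤ h ^ 2 * (4 * L * (P y - P wstar) + 4 * (L - μ) * (P w - P wstar)) :=
    mul_le_mul_of_nonneg_left (by linarith) (by positivity)
  nlinarith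

lemma aux_first_step {d n : ℕ}
    (hn : 0 < n)
    (f : Fin n → EuclideanSpace ℝ (Fin d) → ℝ)
    (f' : Fin n → EuclideanSpace ℝ (Fin d) → EuclideanSpace ℝ (Fin d))
    (hgrad : ∀ i x, HasGradientAt (f i) (f' i x) x)
    (hconvex : ∀ i, ConvexOn ℝ Set.univ (f i))
    (L : ℝ)
    (hL : 0 < L)
    (hLip : ∀ i (x y : EuclideanSpace ℝ (Fin d)), ‖f' i x - f' i y‖ ≤ L * ‖x - y‖)
    (P : EuclideanSpace ℝ (Fin d) → ℝ)
    (hP : ∀ w, P w = (1 / (n : ℝ)) * ∑ i, f i w)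
    (P' : EuclideanSpace ℝ (Fin d) → EuclideanSpace ℝ (Fin d))
    (hP' : ∀ w, P' w = (1 / (n : ℝ)) • ∑ i, f' i w)
    (μ : ℝ)
    (hμ : 0 < μ)
    (hstrong : ∀ x z : EuclideanSpace ℝ (Fin d), P x + ⟪P' x, z - x⟫ + μ / 2 * ‖z - x‖ ^ 2 ≤ P z)
    (wstar : EuclideanSpace ℝ (Fin d))
    (hmin : ∀ w, P wstar ≤ P w)
    (h : ℝ) (hh : 0 < h) (hhL : L * h ≤ 1) (w : EuclideanSpace ℝ (Fin d)) :
    ∑ i, (1 / (n : ℝ)) * ‖s2gdInnerStep f' h w (P' w) i w - wstar‖ ^ 2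
      ≤ ‖w - wstar‖ ^ 2 := by
  have e : ∀ i, s2gdInnerStep f' h w (P' w) i w - wstar = (w - wstar) - h • P' w := by
    intro i; unfold s2gdInnerStep; rw [add_sub_cancel_right]; abel
  simp only [e]
  rw [← Finset.sum_mul, aux_c hn, one_mul, norm_sub_sq_real, real_inner_smul_right, norm_smul,
    mul_pow, Real.norm_of_nonneg hh.le]
  have g := aux_gsq hn f f' hgrad hconvex L hL hLip P hP P' hP' wstar hmin w
  have st := hstrong w wstar
  have e5 : ⟪P' w, wstar - w⟫ = - ⟪w - wstar, P' w⟫ := by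
    rw [← real_inner_comm, ← inner_neg_left, neg_sub]
  rw [e5] at st
  have hp := hmin w
  have hr : 0 ≤ μ / 2 * ‖wstar - w‖ ^ 2 := by positivity
  have k1 : h * (P w - P wstar) ≤ h * ⟪w - wstar, P' w⟫ :=
    mul_le_mul_of_nonneg_left (by linarith) hh.le
  have k2 := mul_le_mul_of_nonneg_left g (sq_nonneg h)
  have k3 : 0 ≤ (h * (P w - P wstar)) * (1 - L * h) :=
    mul_nonneg (mul_nonneg hh.le (by linarith)) (by linarith)
  nlinarith

lemma aux_epoch {d n : ℕ}
    (hn : 0 < n)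
    (f : Fin n → EuclideanSpace ℝ (Fin d) → ℝ)
    (f' : Fin n → EuclideanSpace ℝ (Fin d) → EuclideanSpace ℝ (Fin d))
    (hgrad : ∀ i x, HasGradientAt (f i) (f' i x) x)
    (hconvex : ∀ i, ConvexOn ℝ Set.univ (f i))
    (L : ℝ)
    (hL : 0 < L)
    (hLip : ∀ i (x y : EuclideanSpace ℝ (Fin d)), ‖f' i x - f' i y‖ ≤ L * ‖x - y‖)
    (P : EuclideanSpace ℝ (Fin d) → ℝ)
    (hP : ∀ w, P w = (1 / (n : ℝ)) * ∑ i, f i w)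
    (P' : EuclideanSpace ℝ (Fin d) → EuclideanSpace ℝ (Fin d))
    (hP' : ∀ w, P' w = (1 / (n : ℝ)) • ∑ i, f' i w)
    (μ : ℝ)
    (hμ : 0 < μ)
    (hstrong : ∀ x z : EuclideanSpace ℝ (Fin d), P x + ⟪P' x, z - x⟫ + μ / 2 * ‖z - x‖ ^ 2 ≤ P z)
    (wstar : EuclideanSpace ℝ (Fin d))
    (hmin : ∀ w, P wstar ≤ P w)
    (h ν β Δ : ℝ) (hh : 0 < h) (hν : ν ≤ μ) (hhL : 2 * L * h < 1)
    (m : ℕ) (hβ0 : 0 < β) (hμL : μ < L)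
    (hβ : β = ∑ t ∈ Finset.range m, (1 - ν * h) ^ (m - (t + 1)))
    (hΔ : 0 < Δ) (hrel : 1 - 2 * L * h = h * (4 / Δ) * (L - μ))
    (hkey : (1 - ν * h) ^ m ≤ 2 * β * μ * h ^ 2 * (L - μ)) (w : EuclideanSpace ℝ (Fin d)) :
    ∑ a : Fin m × (Fin m → Fin n), ((1 - ν * h) ^ (m - ((a.1 : ℕ) + 1)) / β)
        * ((1 : ℝ) / (n : ℝ)) ^ m
        * (P (s2gdEpoch f' P' h m w ((a.1 : ℕ) + 1) a.2) - P wstar)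
      ≤ Δ * (P w - P wstar) := by
  have hνh : ν * h ≤ μ * h := mul_le_mul_of_nonneg_right hν hh.le
  have hμh : μ * h < L * h := mul_lt_mul_of_pos_right hμL hh
  have hLh : 0 < L * h := mul_pos hL hh
  have hq : 0 ≤ 1 - ν * h := by linarith
  set q := 1 - ν * h with hqdef
  set A := auxA (1 / (n : ℝ)) (fun i y => s2gdInnerStep f' h w (P' w) i y) with hA
  set p : EuclideanSpace ℝ (Fin d) → ℝ := fun y => P y - P wstar with hp
  set R : EuclideanSpace ℝ (Fin d) → ℝ := fun y => ‖y - wstar‖ ^ 2 with hR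
  have hsum : ∑ a : Fin m × (Fin m → Fin n), (q ^ (m - ((a.1 : ℕ) + 1)) / β)
        * ((1 : ℝ) / (n : ℝ)) ^ m
        * (P (s2gdEpoch f' P' h m w ((a.1 : ℕ) + 1) a.2) - P wstar)
      = (1 / β) * ∑ t ∈ Finset.range m, q ^ (m - (t + 1)) * A^[t + 1] p w := by
    rw [Fintype.sum_prod_type, ← Fin.sum_univ_eq_sum_range
      (fun t => q ^ (m - (t + 1)) * A^[t + 1] p w), Finset.mul_sum]
    refine Finset.sum_congr rfl fun t _ => ?_
    have := aux_fold_A (1 / (n : ℝ)) (aux_c hn) (fun i y => s2gdInnerStep f' h w (P' w) i y) p m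
      ((t : ℕ) + 1) (by omega) w
    rw [← this, Finset.mul_sum, Finset.mul_sum]
    refine Finset.sum_congr rfl fun σ _ => ?_
    simp only [hp, s2gdEpoch]
    ring
  rw [hsum]
  have hstep : ∀ y, A R y ≤ q * R y + (-(2 * h * (1 - 2 * L * h))) * p y
        + 4 * (L - μ) * h ^ 2 * p w := fun y =>
    aux_step hn f f' hgrad hconvex L hL hLip P hP P' hP' μ hμ hstrong wstar hmin h ν hh hν w y
  have hfirst : A R w ≤ R w :=
    aux_first_step hn f f' hgrad hconvex L hL hLip P hP P' hP' μ hμ hstrong wstar hmin h hh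
      (by linarith) w
  have hrec : ∀ t, A^[t + 1 + 1] R w + 2 * h * (1 - 2 * L * h) * A^[t + 1] p w
      ≤ q * A^[t + 1] R w + 4 * (L - μ) * h ^ 2 * p w := by
    intro t
    have := auxA_iter_le (1 / (n : ℝ)) (by positivity) (aux_c hn)
      (fun i y => s2gdInnerStep f' h w (P' w) i y) (A R) R p _ _ _ hstep (t + 1) w
    rw [Function.iterate_succ_apply (f := A) (n := t + 1)]
    linarith
  have htel := aux_telescope (fun t => A^[t + 1] R w) (fun t => A^[t + 1] p w) q
    (2 * h * (1 - 2 * L * h)) (4 * (L - μ) * h ^ 2 * p w) hq hrec m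
  simp only [← hβ] at htel
  set S := ∑ t ∈ Finset.range m, q ^ (m - (t + 1)) * A^[t + 1] p w with hS
  have hnn : ∀ t y, 0 ≤ A^[t] R y := by
    intro t
    induction t with
    | zero => intro y; exact sq_nonneg _
    | succ t ih =>
      intro y
      rw [Function.iterate_succ_apply']
      exact Finset.sum_nonneg fun i _ => mul_nonneg (by positivity) (ih _)
  have hr0 : R w ≤ 2 / μ * p w := by
    have st := hstrong wstar w
    rw [aux_grad_zero f f' hgrad P hP P' hP' wstar hmin, inner_zero_left] at st
    have : μ * R w ≤ 2 * p w := by simp only [hR, hp]; linarith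
    rw [div_mul_eq_mul_div, le_div_iff₀ hμ]; linarith
  have hp0 : 0 ≤ p w := sub_nonneg.2 (hmin w)
  have h1 : 2 * h * (1 - 2 * L * h) * S ≤ q ^ m * (2 / μ * p w) + 4 * (L - μ) * h ^ 2 * p w * β := by
    have a1 := hnn (m + 1) w
    have a2 : q ^ m * A^[0 + 1] R w ≤ q ^ m * (2 / μ * p w) :=
      mul_le_mul_of_nonneg_left (hfirst.trans hr0) (by positivity)
    linarith
  have h2 : q ^ m * (2 / μ * p w) ≤ 4 * β * h ^ 2 * (L - μ) * p w := by
    have : 0 ≤ 2 / μ * p w := by positivity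
    calc _ ≤ 2 * β * μ * h ^ 2 * (L - μ) * (2 / μ * p w) := mul_le_mul_of_nonneg_right hkey this
      _ = _ := by field_simp; ring
  have hLμ : 0 < L - μ := by linarith
  have h3 : 8 * h ^ 2 * (L - μ) / Δ * S ≤ 8 * h ^ 2 * (L - μ) / Δ * (Δ * p w * β) := by
    have e1 : 2 * h * (1 - 2 * L * h) * S = 8 * h ^ 2 * (L - μ) / Δ * S := by
      rw [hrel]; field_simp; ring
    have e2 : 8 * h ^ 2 * (L - μ) / Δ * (Δ * p w * β) = 8 * h ^ 2 * (L - μ) * p w * β := by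
      field_simp
    rw [e2, ← e1]; linarith
  have h4 := le_of_mul_le_mul_left h3 (by positivity)
  rw [one_div, inv_mul_le_iff₀ hβ0]
  linarith
end main

/-- **S2GD with (nearly) optimal parameters** (Theorem 2.6 of Konečný's thesis).
Assume additionally `μ < L`.  Fix `k ≥ 1`, `0 < ε < 1`, set `Δ = ε^{1/k}` and `κ = L/μ`.
If S2GD is run for `k` epochs with stepsize `h = 1/((4/Δ)(L−μ) + 2L)` and either
`ν = μ` with `m ≥ (4(κ−1)/Δ + 2κ) log(2/Δ + (2κ−1)/(κ−1))`, or
`ν = 0` with `m ≥ 8(κ−1)/Δ² + 8κ/Δ + 2κ²/(κ−1)`, then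
`E[P(w^k) − P(w*)] ≤ ε (P(w^0) − P(w*))`. -/
theorem s2gd_optimal_parameters
    (d n : ℕ) (hn : 0 < n)
    (f : Fin n → EuclideanSpace ℝ (Fin d) → ℝ)
    (f' : Fin n → EuclideanSpace ℝ (Fin d) → EuclideanSpace ℝ (Fin d))
    (hgrad : ∀ i x, HasGradientAt (f i) (f' i x) x)
    (hconvex : ∀ i, ConvexOn ℝ Set.univ (f i))
    (L : ℝ) (hL : 0 < L)
    (hLip : ∀ i (x y : EuclideanSpace ℝ (Fin d)), ‖f' i x - f' i y‖ ≤ L * ‖x - y‖)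
    (P : EuclideanSpace ℝ (Fin d) → ℝ)
    (hP : ∀ w, P w = (1 / (n : ℝ)) * ∑ i, f i w)
    (P' : EuclideanSpace ℝ (Fin d) → EuclideanSpace ℝ (Fin d))
    (hP' : ∀ w, P' w = (1 / (n : ℝ)) • ∑ i, f' i w)
    (μ : ℝ) (hμ : 0 < μ) (hμL : μ < L)
    (hstrong : ∀ x z : EuclideanSpace ℝ (Fin d),
      P x + ⟪P' x, z - x⟫ + μ / 2 * ‖z - x‖ ^ 2 ≤ P z)
    (wstar : EuclideanSpace ℝ (Fin d)) (hmin : ∀ w, P wstar ≤ P w)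
    (k : ℕ) (hk : 1 ≤ k) (ε : ℝ) (hε0 : 0 < ε) (hε1 : ε < 1)
    (Δ : ℝ) (hΔ : Δ = ε ^ ((1 : ℝ) / (k : ℝ)))
    (κ : ℝ) (hκ : κ = L / μ)
    (m : ℕ) (hm : 1 ≤ m) (h ν : ℝ)
    (hh : h = 1 / ((4 / Δ) * (L - μ) + 2 * L))
    (hcase :
      (ν = μ ∧ (4 * (κ - 1) / Δ + 2 * κ) * Real.log (2 / Δ + (2 * κ - 1) / (κ - 1)) ≤ (m : ℝ))
        ∨ (ν = 0 ∧ 8 * (κ - 1) / Δ ^ 2 + 8 * κ / Δ + 2 * κ ^ 2 / (κ - 1) ≤ (m : ℝ)))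
    (β : ℝ) (hβ : β = ∑ t ∈ Finset.range m, (1 - ν * h) ^ (m - (t + 1)))
    (w0 : EuclideanSpace ℝ (Fin d)) :
    ∑ ω : Fin k → Fin m × (Fin m → Fin n),
        s2gdWeight n ν h β m ω * (P (s2gdIterate f' P' h m w0 k ω) - P wstar)
      ≤ ε * (P w0 - P wstar) := by
  have hk0 : (k : ℝ) ≠ 0 := by positivity
  have hΔ0 : 0 < Δ := by rw [hΔ]; positivity
  have hΔk : Δ ^ k = ε := by
    rw [hΔ, ← Real.rpow_natCast, ← Real.rpow_mul hε0.le, one_div, inv_mul_cancel₀ hk0,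
      Real.rpow_one]
  have hLμ : 0 < L - μ := by linarith
  have hD : 0 < (4 / Δ) * (L - μ) + 2 * L := by positivity
  have hh0 : 0 < h := by rw [hh]; positivity
  have hhD : h * ((4 / Δ) * (L - μ) + 2 * L) = 1 := by
    rw [hh]; exact one_div_mul_cancel hD.ne'
  have hrel : 1 - 2 * L * h = h * (4 / Δ) * (L - μ) := by linarith
  have hhL : 2 * L * h < 1 := by
    have : 0 < h * (4 / Δ) * (L - μ) := by positivity
    linarith
  have hκ1 : κ - 1 = (L - μ) / μ := by rw [hκ]; field_simp
  have hνb : 0 ≤ ν ∧ ν ≤ μ := by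
    rcases hcase with ⟨h1, _⟩ | ⟨h1, _⟩ <;> constructor <;> linarith
  have hνh : ν * h ≤ μ * h := mul_le_mul_of_nonneg_right hνb.2 hh0.le
  have hμh : μ * h < L * h := mul_lt_mul_of_pos_right hμL hh0
  have hLh : 0 < L * h := mul_pos hL hh0
  have hq : 0 < 1 - ν * h := by linarith
  have hβ0 : 0 < β := by
    rw [hβ]
    exact Finset.sum_pos (fun t _ => by positivity) (Finset.nonempty_range_iff.2 (by omega))
  have hkey : (1 - ν * h) ^ m ≤ 2 * β * μ * h ^ 2 * (L - μ) := by
    clear hh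
    rcases hcase with ⟨h1, h2⟩ | ⟨h1, h2⟩
    · subst h1
      have hβq : β * (ν * h) = 1 - (1 - ν * h) ^ m := by
        rw [hβ]
        have e := Finset.sum_range_reflect (fun j => (1 - ν * h) ^ j) m
        have e2 : ∑ t ∈ Finset.range m, (1 - ν * h) ^ (m - (t + 1))
            = ∑ j ∈ Finset.range m, (1 - ν * h) ^ j := by
          rw [← e]
          refine Finset.sum_congr rfl fun t _ => ?_
          congr 1; omega
        rw [e2]
        have := geom_sum_mul (1 - ν * h) m
        linarith
      have ec : 4 * (κ - 1) / Δ + 2 * κ = 1 / (ν * h) := by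
        rw [hκ1, hκ, eq_div_iff (by positivity), ← hhD]; field_simp
      have ea : 2 / Δ + (2 * κ - 1) / (κ - 1) = 1 + 1 / (2 * h * (L - ν)) := by
        have e1 : 2 * κ - 1 = (2 * L - ν) / ν := by rw [hκ]; field_simp
        have e2 : 1 / (2 * h * (L - ν)) = ((4 / Δ) * (L - ν) + 2 * L) / (2 * (L - ν)) := by
          rw [div_eq_div_iff (by positivity) (by positivity)]
          linear_combination (-2 * (L - ν)) * hhD
        rw [hκ1, e1, e2]; field_simp; ring
      rw [ec, ea] at h2
      set a := 1 + 1 / (2 * h * (L - ν)) with hadef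
      have ha : 0 < a := by positivity
      have h3 : Real.log a ≤ m * (ν * h) := by
        rw [div_mul_eq_mul_div, one_mul, div_le_iff₀ (by positivity)] at h2; exact h2
      have h4 : (1 - ν * h) ^ m ≤ a⁻¹ := by
        calc (1 - ν * h) ^ m ≤ (Real.exp (-(ν * h))) ^ m :=
              pow_le_pow_left₀ hq.le (Real.one_sub_le_exp_neg _) m
          _ = Real.exp (-(m * (ν * h))) := by rw [← Real.exp_nat_mul]; congr 1; ring
          _ ≤ Real.exp (-Real.log a) := Real.exp_le_exp.2 (by linarith)
          _ = a⁻¹ := by rw [Real.exp_neg, Real.exp_log ha]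
      have h5 : (1 - ν * h) ^ m * a ≤ 1 := by
        rw [← le_div_iff₀ ha, one_div]; exact h4
      have h6 : 2 * h * (L - ν) * a = 2 * h * (L - ν) + 1 := by
        rw [hadef]; field_simp
      have h7 := mul_le_mul_of_nonneg_left h5 (show 0 ≤ 2 * h * (L - ν) by positivity)
      have h8 : 2 * β * ν * h ^ 2 * (L - ν) = 2 * h * (L - ν) * (β * (ν * h)) := by ring
      rw [h8, hβq]
      have h9 : 2 * h * (L - ν) * ((1 - ν * h) ^ m * a)
          = (1 - ν * h) ^ m * (2 * h * (L - ν) * a) := by ring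
      rw [h9, h6] at h7
      linarith
    · subst h1
      have hβm : β = m := by rw [hβ]; simp
      rw [hβm]
      have e : 8 * (κ - 1) / Δ ^ 2 + 8 * κ / Δ + 2 * κ ^ 2 / (κ - 1)
          = ((4 / Δ) * (L - μ) + 2 * L) ^ 2 / (2 * μ * (L - μ)) := by
        rw [hκ1, hκ]; field_simp; ring
      rw [e, div_le_iff₀ (by positivity)] at h2
      have h3 := mul_le_mul_of_nonneg_left h2 (sq_nonneg h)
      rw [← mul_pow, hhD] at h3
      simp only [zero_mul, sub_zero, one_pow] at h3 ⊢
      linarith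
  have hep := aux_epoch hn f f' hgrad hconvex L hL hLip P hP P' hP' μ hμ hstrong wstar hmin
    h ν β Δ hh0 hνb.2 hhL m hβ0 hμL hβ hΔ0 hrel hkey
  have := aux_fold_contract
    (fun a : Fin m × (Fin m → Fin n) => ((1 - ν * h) ^ (m - ((a.1 : ℕ) + 1)) / β)
        * ((1 : ℝ) / (n : ℝ)) ^ m)
    (fun a => by positivity)
    (fun a w => s2gdEpoch f' P' h m w ((a.1 : ℕ) + 1) a.2)
    (fun w => P w - P wstar) Δ hep hΔ0.le k w0
  rw [hΔk] at this
  exact this
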